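/- arXiv:1011.0397 — 2 statements merged into one kernel-verified Lean document; each statement's English description precedes it below -/
import Mathlib

section
/- Let L be a finite nonempty set of locations partitioned into reachability locations L_r and safety locations L_s, with enabled actions Σ(l) and generator Q as in a normed continuous-time Markov game structure. Fix t ∈ ℝ, ε > 0, and c ∈ ℝ. Suppose f : L → ℝ → ℝ solves the Bellman equations on [t−ε, t] with terminal value x : L → ℝ, and g : L → ℝ → ℝ solves the Bellman equations on [t−ε, t] with terminal value l ↦ x(l) + c. Then g(l, τ) = f(l, τ) + c for every l ∈ L and every τ ∈ [t−ε, t]. -/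
/-- A normed continuous-time Markov game structure: a finite nonempty set `L` of
locations partitioned into reachability locations (`isReach l = true`) and safety
locations (`isReach l = false`), a finite set `A` of actions with a nonempty set
`enabled l` of enabled actions at each location, and a rate matrix `R` whose rows
(for enabled actions) are probability distributions on `L`. -/
structure NCTMG (L A : Type) [Fintype L] [DecidableEq L] [Fintype A] where
  isReach : L → Bool
  enabled : L → Finset A
  enabled_nonempty : ∀ l, (enabled l).Nonempty
  R : L → A → L → ℝ
  R_nonneg : ∀ l a l', a ∈ enabled l → 0 ≤ R l a l'
  R_sum : ∀ l a, a ∈ enabled l → (∑ l', R l a l') = 1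

namespace NCTMG

variable {L A : Type} [Fintype L] [DecidableEq L] [Fintype A]

/-- The generator `Q(l,a,l') = R(l,a,l') − δ_{l,l'}`. -/
def Q (M : NCTMG L A) (l : L) (a : A) (l' : L) : ℝ :=
  M.R l a l' - (if l = l' then 1 else 0)

/-- `opt_l`: maximum over enabled actions at reachability locations, minimum
over enabled actions at safety locations. -/
noncomputable def opt (M : NCTMG L A) (l : L) (v : A → ℝ) : ℝ :=
  if M.isReach l then (M.enabled l).sup' (M.enabled_nonempty l) v
  else (M.enabled l).inf' (M.enabled_nonempty l) v

/-- `f` solves the Bellman equations on `[t−ε, t]` with terminal value `x`. -/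
def SolvesBellman (M : NCTMG L A) (t ε : ℝ) (x : L → ℝ) (f : L → ℝ → ℝ) : Prop :=
  (∀ l, f l t = x l) ∧
  ∀ l, ∀ τ ∈ Set.Icc (t - ε) t,
    HasDerivAt (f l) (-(M.opt l (fun a => ∑ l', M.Q l a l' * f l' τ))) τ

/-- `p1` is a single `ε`-net approximation from terminal value `x` with chosen
actions `act`: each `act l` is enabled and attains `opt_l` of `∑ Q(l,a,·)·x`,
and `p1(l, t−τ) = x(l) + τ·c_l` on `[0,ε]` where `c_l = ∑ Q(l,act l,·)·x`. -/
def IsSingleNet (M : NCTMG L A) (t ε : ℝ) (x : L → ℝ) (act : L → A)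
    (p1 : L → ℝ → ℝ) : Prop :=
  (∀ l, act l ∈ M.enabled l) ∧
  (∀ l, (∑ l', M.Q l (act l) l' * x l') =
      M.opt l (fun a => ∑ l', M.Q l a l' * x l')) ∧
  (∀ l, ∀ τ ∈ Set.Icc (0 : ℝ) ε,
      p1 l (t - τ) = x l + τ * (∑ l', M.Q l (act l) l' * x l'))

end NCTMG

/-- The sup-norm `‖v‖ = max_{l∈L} |v l|` on functions `L → ℝ`. -/
noncomputable def supNorm {L : Type} [Fintype L] [Nonempty L] (v : L → ℝ) : ℝ :=
  Finset.univ.sup' Finset.univ_nonempty (fun l => |v l|)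


namespace NCTMG

/-- Replacing the values at the enabled actions by values that are at most `δ` larger raises
`opt` by at most `δ`. -/
theorem opt_le_opt_add {L A : Type} [Fintype L] [DecidableEq L] [Fintype A]
    (M : NCTMG L A) (l : L) {v w : A → ℝ} {δ : ℝ}
    (h : ∀ a ∈ M.enabled l, v a ≤ w a + δ) : M.opt l v ≤ M.opt l w + δ := by
  unfold opt
  split_ifs
  · refine Finset.sup'_le _ _ fun a ha => (h a ha).trans ?_
    gcongr
    exact Finset.le_sup' w ha
  · rw [← sub_le_iff_le_add]
    refine Finset.le_inf' _ _ fun a ha => ?_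
    rw [sub_le_iff_le_add]
    exact (Finset.inf'_le v ha).trans (h a ha)

theorem abs_opt_sub_opt_le {L A : Type} [Fintype L] [DecidableEq L] [Fintype A]
    (M : NCTMG L A) (l : L) {v w : A → ℝ} {δ : ℝ}
    (h : ∀ a ∈ M.enabled l, |v a - w a| ≤ δ) : |M.opt l v - M.opt l w| ≤ δ := by
  rw [abs_sub_le_iff]
  constructor
  · linarith [M.opt_le_opt_add l (v := v) (w := w) (δ := δ)
      fun a ha => by linarith [(abs_sub_le_iff.mp (h a ha)).1]]
  · linarith [M.opt_le_opt_add l (v := w) (w := v) (δ := δ)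
      fun a ha => by linarith [(abs_sub_le_iff.mp (h a ha)).2]]

theorem sum_Q_mul {L A : Type} [Fintype L] [DecidableEq L] [Fintype A]
    (M : NCTMG L A) (l : L) (a : A) (y : L → ℝ) :
    ∑ l', M.Q l a l' * y l' = ∑ l', M.R l a l' * y l' - y l := by
  simp [Q, sub_mul, Finset.sum_sub_distrib]

theorem sum_Q_mul_add_const {L A : Type} [Fintype L] [DecidableEq L] [Fintype A]
    (M : NCTMG L A) {l : L} {a : A} (ha : a ∈ M.enabled l) (y : L → ℝ) (c : ℝ) :
    ∑ l', M.Q l a l' * (y l' + c) = ∑ l', M.Q l a l' * y l' := by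
  rw [sum_Q_mul M l a fun l' => y l' + c, sum_Q_mul]
  simp only [mul_add, Finset.sum_add_distrib, ← Finset.sum_mul, M.R_sum l a ha]
  ring

theorem abs_sum_Q_mul_le {L A : Type} [Fintype L] [DecidableEq L] [Fintype A]
    (M : NCTMG L A) {l : L} {a : A} (ha : a ∈ M.enabled l) (y : L → ℝ) :
    |∑ l', M.Q l a l' * y l'| ≤ 2 * ‖y‖ := by
  have hR : |∑ l', M.R l a l' * y l'| ≤ ‖y‖ := calc
    |∑ l', M.R l a l' * y l'| ≤ ∑ l', M.R l a l' * ‖y‖ := by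
      refine (Finset.abs_sum_le_sum_abs _ _).trans (Finset.sum_le_sum fun l' _ => ?_)
      rw [abs_mul, abs_of_nonneg (M.R_nonneg l a l' ha)]
      exact mul_le_mul_of_nonneg_left (norm_le_pi_norm y l') (M.R_nonneg l a l' ha)
    _ = ‖y‖ := by rw [← Finset.sum_mul, M.R_sum l a ha, one_mul]
  have hy : |y l| ≤ ‖y‖ := norm_le_pi_norm y l
  rw [sum_Q_mul]
  linarith [abs_sub (∑ l', M.R l a l' * y l') (y l)]

/-- The right-hand side of the Bellman equations. -/
noncomputable def bellmanField {L A : Type} [Fintype L] [DecidableEq L] [Fintype A]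
    (M : NCTMG L A) (y : L → ℝ) (l : L) : ℝ :=
  -(M.opt l fun a => ∑ l', M.Q l a l' * y l')

theorem lipschitzWith_bellmanField {L A : Type} [Fintype L] [DecidableEq L] [Fintype A]
    (M : NCTMG L A) : LipschitzWith 2 M.bellmanField := by
  refine LipschitzWith.of_dist_le_mul fun y z => ?_
  refine (dist_pi_le_iff (by positivity)).mpr fun l => ?_
  rw [bellmanField, bellmanField, dist_neg_neg, Real.dist_eq, dist_eq_norm]
  refine M.abs_opt_sub_opt_le l fun a ha => ?_
  rw [← Finset.sum_sub_distrib]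
  simpa [mul_sub] using M.abs_sum_Q_mul_le ha (y - z)

theorem bellmanField_add_const {L A : Type} [Fintype L] [DecidableEq L] [Fintype A]
    (M : NCTMG L A) (y : L → ℝ) (c : ℝ) :
    M.bellmanField (fun l => y l + c) = M.bellmanField y := by
  funext l
  have h := M.abs_opt_sub_opt_le l (v := fun a => ∑ l', M.Q l a l' * (y l' + c))
    (w := fun a => ∑ l', M.Q l a l' * y l') (δ := 0)
    fun a ha => by simp [M.sum_Q_mul_add_const ha]
  exact congrArg Neg.neg (sub_eq_zero.mp (abs_nonpos_iff.mp h))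

theorem SolvesBellman.hasDerivAt {L A : Type} [Fintype L] [DecidableEq L] [Fintype A]
    {M : NCTMG L A} {t ε : ℝ} {x : L → ℝ} {f : L → ℝ → ℝ} (hf : M.SolvesBellman t ε x f)
    {τ : ℝ} (hτ : τ ∈ Set.Icc (t - ε) t) :
    HasDerivAt (fun s l => f l s) (M.bellmanField fun l => f l τ) τ :=
  hasDerivAt_pi.mpr fun l => hf.2 l τ hτ

/-- Solutions of the Bellman equations are determined by their terminal value. -/
theorem SolvesBellman.eqOn {L A : Type} [Fintype L] [DecidableEq L] [Fintype A]
    {M : NCTMG L A} {t ε : ℝ} {x : L → ℝ} {f g : L → ℝ → ℝ}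
    (hf : M.SolvesBellman t ε x f) (hg : M.SolvesBellman t ε x g) :
    Set.EqOn (fun s l => f l s) (fun s l => g l s) (Set.Icc (t - ε) t) :=
  ODE_solution_unique_of_mem_Icc_left (v := fun _ => M.bellmanField) (s := fun _ => Set.univ)
    (fun _ _ => M.lipschitzWith_bellmanField.lipschitzOnWith)
    (fun _ hτ => (hf.hasDerivAt hτ).continuousAt.continuousWithinAt)
    (fun _ hτ => (hf.hasDerivAt (Set.Ioc_subset_Icc_self hτ)).hasDerivWithinAt)
    (fun _ _ => Set.mem_univ _)
    (fun _ hτ => (hg.hasDerivAt hτ).continuousAt.continuousWithinAt)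
    (fun _ hτ => (hg.hasDerivAt (Set.Ioc_subset_Icc_self hτ)).hasDerivWithinAt)
    (fun _ _ => Set.mem_univ _)
    (funext fun l => (hf.1 l).trans (hg.1 l).symm)

theorem SolvesBellman.add_const {L A : Type} [Fintype L] [DecidableEq L] [Fintype A]
    {M : NCTMG L A} {t ε : ℝ} {x : L → ℝ} {f : L → ℝ → ℝ}
    (hf : M.SolvesBellman t ε x f) (c : ℝ) :
    M.SolvesBellman t ε (fun l => x l + c) (fun l τ => f l τ + c) := by
  refine ⟨fun l => congrArg (· + c) (hf.1 l), fun l τ hτ => ?_⟩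
  change HasDerivAt _ (M.bellmanField (fun l => f l τ + c) l) τ
  rw [M.bellmanField_add_const (fun l => f l τ)]
  exact (hf.2 l τ hτ).add_const c

end NCTMG

/-- shifting the terminal value of the Bellman equations by a
constant `c` shifts the solution by `c` throughout `[t−ε, t]`. -/
theorem bellman_shift_const {L A : Type} [Fintype L] [DecidableEq L] [Nonempty L]
    [Fintype A] (M : NCTMG L A) (t ε c : ℝ) (hε : 0 < ε) (x : L → ℝ)
    (f g : L → ℝ → ℝ)
    (hf : M.SolvesBellman t ε x f)
    (hg : M.SolvesBellman t ε (fun l => x l + c) g) :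
    ∀ l, ∀ τ ∈ Set.Icc (t - ε) t, g l τ = f l τ + c :=
  fun l _ hτ => congrFun (hg.eqOn (hf.add_const c) hτ) l
end

section
/- Let L be a finite nonempty set, Σ(l) ⊆ A a finite nonempty set of enabled actions at a location l, with rows R(l,a,·) : L → ℝ satisfying R(l,a,l') ≥ 0 and Σ_{l'∈L} R(l,a,l') = 1, and Q(l,a,l') = R(l,a,l') − δ_{l,l'}. Let f, g : L → ℝ with |f(l') − g(l')| ≤ δ for all l' ∈ L. Let a_f ∈ Σ(l) maximize Σ_{l'} Q(l,a,l')·f(l') over a ∈ Σ(l) and a_g ∈ Σ(l) maximize Σ_{l'} Q(l,a,l')·g(l') over a ∈ Σ(l) (or both minimize their respective expressions). Then |Σ_{l'} R(l,a_g,l')·g(l') − Σ_{l'} R(l,a_f,l')·f(l')| ≤ 3·δ. -/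
/-- Averages of `f` and `g` against the same probability vector differ by at most the uniform
distance between `f` and `g`. -/
theorem abs_sum_mul_sub_sum_mul_le {ι : Type*} [Fintype ι] {p f g : ι → ℝ} {δ : ℝ}
    (hp : ∀ i, 0 ≤ p i) (hsum : ∑ i, p i = 1) (hfg : ∀ i, |f i - g i| ≤ δ) :
    |∑ i, p i * f i - ∑ i, p i * g i| ≤ δ := by
  calc |∑ i, p i * f i - ∑ i, p i * g i| = |∑ i, p i * (f i - g i)| := by
        simp only [mul_sub, Finset.sum_sub_distrib]
    _ ≤ ∑ i, |p i * (f i - g i)| := Finset.abs_sum_le_sum_abs _ _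
    _ ≤ ∑ i, p i * δ := Finset.sum_le_sum fun i _ => by
        rw [abs_mul, abs_of_nonneg (hp i)]
        exact mul_le_mul_of_nonneg_left (hfg i) (hp i)
    _ = δ := by rw [← Finset.sum_mul, hsum, one_mul]


/-- if `f` and `g` differ pointwise by at most `δ`, and `a_f`,
`a_g` respectively optimise (both maximise, or both minimise) the generator
expressions `∑ Q·f` and `∑ Q·g` over the enabled actions, then the resulting
one-step values `∑ R(l,a_g,·)·g` and `∑ R(l,a_f,·)·f` differ by at most `3δ`. -/
theorem optimising_actions_close {L A : Type} [Fintype L] [DecidableEq L]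
    [Nonempty L]
    (l : L) (Sig : Finset A) (hSig : Sig.Nonempty)
    (R : A → L → ℝ)
    (hR : ∀ a ∈ Sig, ∀ l', 0 ≤ R a l')
    (hsum : ∀ a ∈ Sig, (∑ l', R a l') = 1)
    (Q : A → L → ℝ)
    (hQ : ∀ a l', Q a l' = R a l' - (if l = l' then 1 else 0))
    (f g : L → ℝ) (δ : ℝ) (hfg : ∀ l', |f l' - g l'| ≤ δ)
    (af ag : A) (haf : af ∈ Sig) (hag : ag ∈ Sig)
    (hopt :
      ((∀ a ∈ Sig, (∑ l', Q a l' * f l') ≤ ∑ l', Q af l' * f l') ∧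
       (∀ a ∈ Sig, (∑ l', Q a l' * g l') ≤ ∑ l', Q ag l' * g l')) ∨
      ((∀ a ∈ Sig, (∑ l', Q af l' * f l') ≤ ∑ l', Q a l' * f l') ∧
       (∀ a ∈ Sig, (∑ l', Q ag l' * g l') ≤ ∑ l', Q a l' * g l'))) :
    |(∑ l', R ag l' * g l') - (∑ l', R af l' * f l')| ≤ 3 * δ := by
  have hδ : 0 ≤ δ := (abs_nonneg _).trans (hfg l)
  have hQR (a : A) (h : L → ℝ) : ∑ l', Q a l' * h l' = ∑ l', R a l' * h l' - h l := by
    simp [hQ, sub_mul, Finset.sum_sub_distrib]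
  simp only [hQR, sub_le_sub_iff_right] at hopt
  have hf := abs_le.mp (abs_sum_mul_sub_sum_mul_le (hR af haf) (hsum af haf) hfg)
  have hg := abs_le.mp (abs_sum_mul_sub_sum_mul_le (hR ag hag) (hsum ag hag) hfg)
  rw [abs_le]
  rcases hopt with ⟨hof, hog⟩ | ⟨hof, hog⟩ <;>
    constructor <;> linarith [hof ag hag, hog af haf]
end
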